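/- arXiv:1907.11112 — 2 statements merged into one kernel-verified Lean document; each statement's English description precedes it below -/
import Mathlib

section
/- Let G_K be the knowledge graph associated to a sentence graph G_T and distinct instance nodes x, y, let G_S be a sentence graph, and let M be a set of pairs between nodes of G_S' and nodes of G_K' satisfying condition (i) of a matching. Then for all nodes p and a of G_S', a is retrieved as an answer with respect to M (i.e., the Step-4 condition of the WiSCR algorithm, including its non-existence clause, holds for p and a) if and only if a provides the most natural resolution for p with respect to M. In particular, the non-existence clause of Step 4 is automatically satisfied whenever the remaining conditions hold. -/
/-- An edge-labeled directed graph representing the sentences of a WSC problem: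
a finite vertex set partitioned into instance nodes `inst` (V₁) and class nodes
`cls` (V₂), an edge set partitioned into `E1 ⊆ V₁ × V₁` and `E2 ⊆ V₁ × V₂`,
where every instance node has at most one outgoing `E2`-edge, every `E2`-edge is
labeled `instOf`, and no `E1`-edge is labeled `instOf` or `isSame`. -/
structure SentenceGraph (V L : Type) [DecidableEq V] (instOf isSame : L) where
  verts : Finset V
  edges : Finset (V × V)
  lab : V × V → L
  inst : Finset V
  cls : Finset V
  E1 : Finset (V × V)
  E2 : Finset (V × V)
  verts_eq : verts = inst ∪ cls
  disj : Disjoint inst cls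
  edges_eq : edges = E1 ∪ E2
  E1_sub : ∀ e ∈ E1, e.1 ∈ inst ∧ e.2 ∈ inst
  E2_sub : ∀ e ∈ E2, e.1 ∈ inst ∧ e.2 ∈ cls
  unique_out : ∀ a c c', (a, c) ∈ E2 → (a, c') ∈ E2 → c = c'
  lab_E2 : ∀ e ∈ E2, lab e = instOf
  lab_E1 : ∀ e ∈ E1, lab e ≠ instOf ∧ lab e ≠ isSame

/-- The knowledge graph associated to a sentence graph `T` and two distinct
instance nodes `x`, `y` of `T` with `(x,y) ∉ E_T` and `(y,x) ∉ E_T`. -/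
structure KnowledgeGraph (V L : Type) [DecidableEq V] (instOf isSame : L) where
  T : SentenceGraph V L instOf isSame
  x : V
  y : V
  x_inst : x ∈ T.inst
  y_inst : y ∈ T.inst
  x_ne_y : x ≠ y
  xy_not_mem : (x, y) ∉ T.edges
  yx_not_mem : (y, x) ∉ T.edges

variable {V L : Type} [DecidableEq V] {instOf isSame : L}

/-- Edge set of the knowledge graph: `E_K = E_T ∪ {(x,y), (y,x)}`. -/
def KnowledgeGraph.edges (K : KnowledgeGraph V L instOf isSame) : Finset (V × V) :=
  insert (K.x, K.y) (insert (K.y, K.x) K.T.edges)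

/-- Labeling of the knowledge graph: `f_K((x,y)) = f_K((y,x)) = isSame`, and
`f_K(e) = f_T(e)` otherwise. -/
def KnowledgeGraph.lab (K : KnowledgeGraph V L instOf isSame) (e : V × V) : L :=
  if e = (K.x, K.y) ∨ e = (K.y, K.x) then isSame else K.T.lab e

/-- The pairs of `M` relate nodes of `G_S'` (instance nodes of `G_S`) to nodes of
`G_K'` (instance nodes of `G_K`). -/
def MatchDom (S : SentenceGraph V L instOf isSame) (K : KnowledgeGraph V L instOf isSame)
    (M : Set (V × V)) : Prop :=
  ∀ q ∈ M, q.1 ∈ S.inst ∧ q.2 ∈ K.T.inst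

/-- Condition (i) of a matching: `M` is one-to-one in both directions. -/
def Cond1 (M : Set (V × V)) : Prop :=
  (∀ a a' b, (a, b) ∈ M → (a', b) ∈ M → a = a') ∧
  (∀ a b b', (a, b) ∈ M → (a, b') ∈ M → b = b')

/-- Condition (ii) of a matching: every node of `G_K'` is the second component
of some pair of `M`. -/
def Cond2 (K : KnowledgeGraph V L instOf isSame) (M : Set (V × V)) : Prop :=
  ∀ b ∈ K.T.inst, ∃ a, (a, b) ∈ M

/-- Condition (iii) of a matching: matched nodes are instances of a common class node. -/
def Cond3 (S : SentenceGraph V L instOf isSame) (K : KnowledgeGraph V L instOf isSame)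
    (M : Set (V × V)) : Prop :=
  ∀ a b, (a, b) ∈ M → ∃ c, c ∈ S.cls ∧ c ∈ K.T.cls ∧
    (a, c) ∈ S.edges ∧ S.lab (a, c) = instOf ∧
    (b, c) ∈ K.edges ∧ K.lab (b, c) = instOf

/-- Condition (iv) of a matching: every edge `(u,v) ∈ E_K'` with label `r` whose
endpoints are matched by `(u',u), (v',v) ∈ M` yields an edge `(u',v') ∈ E_S'` with label `r`. -/
def Cond4 (S : SentenceGraph V L instOf isSame) (K : KnowledgeGraph V L instOf isSame)
    (M : Set (V × V)) : Prop :=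
  ∀ u v u' v', (u, v) ∈ K.edges → K.lab (u, v) ≠ instOf → K.lab (u, v) ≠ isSame →
    (u', u) ∈ M → (v', v) ∈ M →
    (u', v') ∈ S.edges ∧ S.lab (u', v') = K.lab (u, v)

/-- A matching between the instance subgraphs `G_S'` and `G_K'`. -/
def IsMatching (S : SentenceGraph V L instOf isSame) (K : KnowledgeGraph V L instOf isSame)
    (M : Set (V × V)) : Prop :=
  MatchDom S K M ∧ Cond1 M ∧ Cond2 K M ∧ Cond3 S K M ∧ Cond4 S K M

/-- `a` provides the most natural resolution for `p` with respect to `M`. -/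
def ProvidesMNR (K : KnowledgeGraph V L instOf isSame) (M : Set (V × V)) (p a : V) : Prop :=
  ∃ n₁ n₂, (p, n₁) ∈ M ∧ (a, n₂) ∈ M ∧
    (((n₁, n₂) ∈ K.edges ∧ K.lab (n₁, n₂) = isSame) ∨
     ((n₂, n₁) ∈ K.edges ∧ K.lab (n₂, n₁) = isSame))

/-- `a` is retrieved as an answer for the pronoun `p` with respect to `M`
(Step 4 of the WiSCR algorithm, including its non-existence clause). -/
def Retrieved (S : SentenceGraph V L instOf isSame) (K : KnowledgeGraph V L instOf isSame)
    (M : Set (V × V)) (p a : V) : Prop :=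
  ∃ n₁ n₂, (p, n₁) ∈ M ∧ (a, n₂) ∈ M ∧
    (((n₁, n₂) ∈ K.edges ∧ K.lab (n₁, n₂) = isSame) ∨
     ((n₂, n₁) ∈ K.edges ∧ K.lab (n₂, n₁) = isSame)) ∧
    ¬ ∃ n z, z ∈ S.inst ∧ z ≠ a ∧ (z, n) ∈ M ∧
      (((n₁, n) ∈ K.edges ∧ K.lab (n₁, n) = isSame) ∨
       ((n, n₁) ∈ K.edges ∧ K.lab (n, n₁) = isSame))

/-- The WiSCR algorithm outputs `a` (for a problem with pronoun `p` and answer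
choices `a₁`, `a₂`) iff the set of answer choices retrieved with respect to some
matching equals `{a}`. -/
def OutputsAnswer (S : SentenceGraph V L instOf isSame) (K : KnowledgeGraph V L instOf isSame)
    (p a₁ a₂ a : V) : Prop :=
  {z | z ∈ ({a₁, a₂} : Set V) ∧ ∃ M, IsMatching S K M ∧ Retrieved S K M p z} = {a}

theorem isSame_edge_cases (hL : instOf ≠ isSame) (K : KnowledgeGraph V L instOf isSame)
    (u v : V) (he : (u, v) ∈ K.edges) (hl : K.lab (u, v) = isSame) :
    (u = K.x ∧ v = K.y) ∨ (u = K.y ∧ v = K.x) := by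
  by_cases h : (u, v) = (K.x, K.y) ∨ (u, v) = (K.y, K.x)
  · simpa [Prod.ext_iff] using h
  · exfalso
    rw [KnowledgeGraph.lab, if_neg h] at hl
    have hT : (u, v) ∈ K.T.edges := by
      simp only [KnowledgeGraph.edges, Finset.mem_insert] at he
      tauto
    rw [K.T.edges_eq, Finset.mem_union] at hT
    rcases hT with h1 | h2
    · exact (K.T.lab_E1 _ h1).2 hl
    · exact hL ((K.T.lab_E2 _ h2).symm.trans hl)

/-- If `M` is a set of pairs between nodes of `G_S'` and nodes of `G_K'`
satisfying condition (i) of a matching, then for all nodes `p`, `a` of `G_S'`: `a` is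
retrieved as an answer with respect to `M` (Step-4 condition of the WiSCR algorithm,
including its non-existence clause) iff `a` provides the most natural resolution for
`p` with respect to `M`. -/
theorem statement9 (hL : instOf ≠ isSame)
    (S : SentenceGraph V L instOf isSame) (K : KnowledgeGraph V L instOf isSame)
    (M : Set (V × V)) (hdom : MatchDom S K M) (h1 : Cond1 M) :
    ∀ p ∈ S.inst, ∀ a ∈ S.inst,
      (Retrieved S K M p a ↔ ProvidesMNR K M p a) := by
  intro p _ a _
  constructor
  · rintro ⟨n₁, n₂, hp, ha, he, _⟩
    exact ⟨n₁, n₂, hp, ha, he⟩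
  · rintro ⟨n₁, n₂, hp, ha, he⟩
    refine ⟨n₁, n₂, hp, ha, he, ?_⟩
    rintro ⟨n, z, _, hza, hz, hn⟩
    have key : ∀ m, (((n₁, m) ∈ K.edges ∧ K.lab (n₁, m) = isSame) ∨
       ((m, n₁) ∈ K.edges ∧ K.lab (m, n₁) = isSame)) →
       (n₁ = K.x ∧ m = K.y) ∨ (n₁ = K.y ∧ m = K.x) := by
      rintro m (⟨h, h'⟩ | ⟨h, h'⟩)
      · exact isSame_edge_cases hL K _ _ h h'
      · have := isSame_edge_cases hL K _ _ h h'
        tauto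
    have hne := K.x_ne_y
    have e : n = n₂ := by
      have := key _ he
      have := key _ hn
      grind
    subst e
    exact hza (h1.1 _ _ _ hz ha)
end

section
/- (Correctness of the WiSCR algorithm.) Let G_S be a sentence graph with designated distinct instance nodes p (the pronoun) and a₁ ≠ a₂ (the answer choices, with p ∉ {a₁, a₂}), and let G_K be the knowledge graph associated to a sentence graph G_T and distinct instance nodes x, y. Then for each i ∈ {1,2}: the WiSCR algorithm outputs aᵢ if and only if aᵢ provides the most natural resolution for p with respect to some matching M and the other answer choice does not provide the most natural resolution for p with respect to any matching; and the WiSCR algorithm outputs no answer if and only if neither of these two conditions holds. -/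
variable {V L : Type} [DecidableEq V] {instOf isSame : L}

theorem same_edge_aux (hL : instOf ≠ isSame) (K : KnowledgeGraph V L instOf isSame) (u v : V)
    (h : (u, v) ∈ K.edges ∧ K.lab (u, v) = isSame) :
    (u = K.x ∧ v = K.y) ∨ (u = K.y ∧ v = K.x) := by
  obtain ⟨h1, h2⟩ := h
  unfold KnowledgeGraph.edges at h1
  unfold KnowledgeGraph.lab at h2
  by_cases hc : (u, v) = (K.x, K.y) ∨ (u, v) = (K.y, K.x)
  · simpa using hc
  · rw [if_neg hc] at h2
    rw [Finset.mem_insert, Finset.mem_insert] at h1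
    have h3 : (u, v) ∈ K.T.edges := by tauto
    rw [K.T.edges_eq, Finset.mem_union] at h3
    rcases h3 with h3 | h3
    · exact absurd h2 (K.T.lab_E1 _ h3).2
    · exact absurd ((K.T.lab_E2 _ h3).symm.trans h2) hL

theorem retrieved_iff_aux (hL : instOf ≠ isSame)
    (S : SentenceGraph V L instOf isSame) (K : KnowledgeGraph V L instOf isSame)
    (p a : V) (M : Set (V × V)) (hM : IsMatching S K M) :
    Retrieved S K M p a ↔ ProvidesMNR K M p a := by
  constructor
  · rintro ⟨n₁, n₂, h1, h2, h3, -⟩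
    exact ⟨n₁, n₂, h1, h2, h3⟩
  · rintro ⟨n₁, n₂, h1, h2, h3⟩
    refine ⟨n₁, n₂, h1, h2, h3, ?_⟩
    rintro ⟨n, z, -, hza, hzn, h4⟩
    apply hza
    have key : ∀ m, (((n₁, m) ∈ K.edges ∧ K.lab (n₁, m) = isSame) ∨
        ((m, n₁) ∈ K.edges ∧ K.lab (m, n₁) = isSame)) →
        (n₁ = K.x ∧ m = K.y) ∨ (n₁ = K.y ∧ m = K.x) := by
      rintro m (h | h)
      · exact same_edge_aux hL K _ _ h
      · have := same_edge_aux hL K _ _ h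
        tauto
    have hne := K.x_ne_y
    have e : n = n₂ := by
      have k1 := key _ h3
      have k2 := key _ h4
      grind
    subst e
    exact hM.2.1.1 _ _ _ hzn h2

theorem outputs_aux {P : V → Prop} {a b : V} (hab : a ≠ b) :
    ({z | z ∈ ({a, b} : Set V) ∧ P z} = {a} ↔ (P a ∧ ¬ P b)) ∧
    ({z | z ∈ ({a, b} : Set V) ∧ P z} = {b} ↔ (P b ∧ ¬ P a)) := by
  simp only [Set.ext_iff, Set.mem_setOf_eq, Set.mem_insert_iff, Set.mem_singleton_iff]
  constructor <;> constructor
  · intro h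
    have h1 := h a
    have h2 := h b
    grind
  · grind
  · intro h
    have h1 := h a
    have h2 := h b
    grind
  · grind

/-- Correctness of the WiSCR algorithm: For a sentence graph `G_S` with
designated distinct instance nodes `p` (pronoun) and `a₁ ≠ a₂` (answer choices, with
`p ∉ {a₁, a₂}`) and the knowledge graph `G_K`: for each `i ∈ {1,2}` the algorithm
outputs `aᵢ` iff `aᵢ` provides the most natural resolution for `p` with respect to some
matching while the other answer choice does not with respect to any matching; and the
algorithm outputs no answer iff neither of these two conditions holds. -/
theorem statement10 (hL : instOf ≠ isSame)
    (S : SentenceGraph V L instOf isSame) (K : KnowledgeGraph V L instOf isSame)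
    (p a₁ a₂ : V) (hp : p ∈ S.inst) (ha₁ : a₁ ∈ S.inst) (ha₂ : a₂ ∈ S.inst)
    (h12 : a₁ ≠ a₂) (hp1 : p ≠ a₁) (hp2 : p ≠ a₂) :
    (OutputsAnswer S K p a₁ a₂ a₁ ↔
      ((∃ M, IsMatching S K M ∧ ProvidesMNR K M p a₁) ∧
       ¬ ∃ M, IsMatching S K M ∧ ProvidesMNR K M p a₂)) ∧
    (OutputsAnswer S K p a₁ a₂ a₂ ↔
      ((∃ M, IsMatching S K M ∧ ProvidesMNR K M p a₂) ∧
       ¬ ∃ M, IsMatching S K M ∧ ProvidesMNR K M p a₁)) ∧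
    ((¬ OutputsAnswer S K p a₁ a₂ a₁ ∧ ¬ OutputsAnswer S K p a₁ a₂ a₂) ↔
      ¬ (((∃ M, IsMatching S K M ∧ ProvidesMNR K M p a₁) ∧
          ¬ ∃ M, IsMatching S K M ∧ ProvidesMNR K M p a₂) ∨
         ((∃ M, IsMatching S K M ∧ ProvidesMNR K M p a₂) ∧
          ¬ ∃ M, IsMatching S K M ∧ ProvidesMNR K M p a₁))) := by
  have hR : ∀ a, (∃ M, IsMatching S K M ∧ Retrieved S K M p a) ↔
      (∃ M, IsMatching S K M ∧ ProvidesMNR K M p a) := fun a =>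
    exists_congr fun M => and_congr_right fun hM => retrieved_iff_aux hL S K p a M hM
  have hO := outputs_aux (P := fun z => ∃ M, IsMatching S K M ∧ Retrieved S K M p z) h12
  have h1 : OutputsAnswer S K p a₁ a₂ a₁ ↔ _ := hO.1
  have h2 : OutputsAnswer S K p a₁ a₂ a₂ ↔ _ := hO.2
  rw [h1, h2]
  simp only [hR]
  refine ⟨trivial, trivial, ?_⟩
  rw [not_or]
end
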